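/- Let τ be a topology on an n-element set X, and let 1 ≤ j ≤ n-1. If τ contains no open set of cardinality j, then |τ| ≤ 2^{j-1} + 2^{n-j-1}. -/

import Mathlib

def IsTopology {n : ℕ} (τ : Finset (Finset (Fin n))) : Prop :=
  ∅ ∈ τ ∧ Finset.univ ∈ τ ∧
    (∀ s ∈ τ, ∀ t ∈ τ, s ∪ t ∈ τ) ∧ (∀ s ∈ τ, ∀ t ∈ τ, s ∩ t ∈ τ)

/-- A family of subsets of `X` that contains `∅` and `X` and is closed under unions and
intersections. -/
structure IsSetLattice {α : Type*} [DecidableEq α] (τ : Finset (Finset α)) (X : Finset α) :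
    Prop where
  empty_mem : ∅ ∈ τ
  top_mem : X ∈ τ
  subset : ∀ D ∈ τ, D ⊆ X
  union : ∀ D ∈ τ, ∀ E ∈ τ, D ∪ E ∈ τ
  inter : ∀ D ∈ τ, ∀ E ∈ τ, D ∩ E ∈ τ

/-- The members of `τ` lying between `U` and `V`. -/
def between {α : Type*} [DecidableEq α] (τ : Finset (Finset α)) (U V : Finset α) :
    Finset (Finset α) :=
  τ.filter fun D => U ⊆ D ∧ D ⊆ V

/-- No member of `τ` has its cardinality in `[a, b]`. -/
def Avoids {α : Type*} (τ : Finset (Finset α)) (a b : ℕ) : Prop :=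
  ∀ D ∈ τ, ¬ (a ≤ D.card ∧ D.card ≤ b)

/-- Every member of `τ` either contains `M` or is contained in `L`, and not both. -/
structure IsSplit {α : Type*} (τ : Finset (Finset α)) (M L : Finset α) : Prop where
  left_mem : M ∈ τ
  right_mem : L ∈ τ
  not_subset : ¬ M ⊆ L
  cases : ∀ D ∈ τ, M ⊆ D ∨ D ⊆ L

/-- The bound on the number of members of a set lattice avoiding an interval of sizes, for
ground sets with fewer than `n` elements. -/
def BoundBelow (α : Type*) [DecidableEq α] (n : ℕ) : Prop :=
  ∀ (X : Finset α) (τ : Finset (Finset α)) (a b : ℕ), X.card < n → IsSetLattice τ X →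
    1 ≤ a → a ≤ b → b < X.card → Avoids τ a b →
    τ.card ≤ 2 ^ (a - 1) + 2 ^ (X.card - b - 1)

section SetLattice

variable {α : Type*} [DecidableEq α] {τ : Finset (Finset α)} {X U V W M L D : Finset α}
  {a b n : ℕ}

theorem mem_between : D ∈ between τ U V ↔ D ∈ τ ∧ U ⊆ D ∧ D ⊆ V := by
  simp [between]

theorem card_between_le : (between τ U V).card ≤ 2 ^ (V \ U).card := by
  rw [← Finset.card_powerset]
  refine Finset.card_le_card_of_injOn (fun D => D \ U) ?_ ?_
  · intro D hD
    have hD' := mem_between.1 hD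
    exact Finset.mem_powerset.2 (Finset.sdiff_subset_sdiff hD'.2.2 (Finset.Subset.refl U))
  · intro D hD E hE h
    have hD' := mem_between.1 hD
    have hE' := mem_between.1 hE
    simp only at h
    rw [← Finset.sdiff_union_of_subset hD'.2.1, h, Finset.sdiff_union_of_subset hE'.2.1]

theorem card_between_le_mul (h : IsSetLattice τ X) (hW : W ∈ τ) (hUW : U ⊆ W) (hWV : W ⊆ V) :
    (between τ U V).card ≤ (between τ U W).card * (between τ W V).card := by
  rw [← Finset.card_product]
  refine Finset.card_le_card_of_injOn (fun D => (D ∩ W, D ∪ W)) ?_ ?_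
  · intro D hD
    obtain ⟨hD, hUD, hDV⟩ := mem_between.1 hD
    simp only [Finset.coe_product, Set.mem_prod, Finset.mem_coe, mem_between]
    exact ⟨⟨h.inter _ hD _ hW, Finset.subset_inter hUD hUW, Finset.inter_subset_right⟩,
      h.union _ hD _ hW, Finset.subset_union_right, Finset.union_subset hDV hWV⟩
  · intro D _ E _ hDE
    simp only [Prod.mk.injEq] at hDE
    ext y
    have h1 := Finset.ext_iff.1 hDE.1 y
    have h2 := Finset.ext_iff.1 hDE.2 y
    simp only [Finset.mem_inter, Finset.mem_union] at h1 h2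
    tauto

theorem IsSetLattice.between_self (h : IsSetLattice τ X) : between τ ∅ X = τ := by
  ext D
  simp only [mem_between, Finset.empty_subset, true_and, and_iff_left_iff_imp]
  exact h.subset D

theorem BoundBelow.card_between_le (hB : BoundBelow α n) (h : IsSetLattice τ X) (hU : U ∈ τ)
    (hV : V ∈ τ) (hUV : U ⊆ V) (hn : V.card < n + U.card) (ha : U.card < a) (hab : a ≤ b)
    (hb : b < V.card) (hav : Avoids (between τ U V) a b) :
    (between τ U V).card ≤ 2 ^ (a - 1 - U.card) + 2 ^ (V.card - b - 1) := by
  have hcard := Finset.card_sdiff_add_card_eq_card hUV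
  have hinj : Set.InjOn (fun D => D \ U) (between τ U V : Set (Finset α)) := by
    intro D hD E hE h
    have hD' := mem_between.1 hD
    have hE' := mem_between.1 hE
    simp only at h
    rw [← Finset.sdiff_union_of_subset hD'.2.1, h, Finset.sdiff_union_of_subset hE'.2.1]
  have key := hB (V \ U) ((between τ U V).image fun D => D \ U) (a - U.card) (b - U.card)
    (by omega) ?_ (by omega) (by omega) (by omega) ?_
  · rw [Finset.card_image_of_injOn hinj] at key
    have e1 : a - U.card - 1 = a - 1 - U.card := by omega
    have e2 : (V \ U).card - (b - U.card) - 1 = V.card - b - 1 := by omega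
    rwa [e1, e2] at key
  · constructor
    · exact Finset.mem_image.2 ⟨U, mem_between.2 ⟨hU, subset_rfl, hUV⟩, by simp⟩
    · exact Finset.mem_image.2 ⟨V, mem_between.2 ⟨hV, hUV, subset_rfl⟩, rfl⟩
    · intro D hD
      obtain ⟨E, hE, rfl⟩ := Finset.mem_image.1 hD
      exact Finset.sdiff_subset_sdiff (mem_between.1 hE).2.2 subset_rfl
    · intro D hD E hE
      obtain ⟨D, hD₀, rfl⟩ := Finset.mem_image.1 hD
      obtain ⟨E, hE₀, rfl⟩ := Finset.mem_image.1 hE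
      have hD' := mem_between.1 hD₀
      have hE' := mem_between.1 hE₀
      refine Finset.mem_image.2 ⟨D ∪ E, mem_between.2 ⟨h.union _ hD'.1 _ hE'.1,
        hD'.2.1.trans Finset.subset_union_left, Finset.union_subset hD'.2.2 hE'.2.2⟩, ?_⟩
      exact Finset.union_sdiff_distrib D E U
    · intro D hD E hE
      obtain ⟨D, hD₀, rfl⟩ := Finset.mem_image.1 hD
      obtain ⟨E, hE₀, rfl⟩ := Finset.mem_image.1 hE
      have hD' := mem_between.1 hD₀
      have hE' := mem_between.1 hE₀
      refine Finset.mem_image.2 ⟨D ∩ E, mem_between.2 ⟨h.inter _ hD'.1 _ hE'.1,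
        Finset.subset_inter hD'.2.1 hE'.2.1, Finset.inter_subset_left.trans hD'.2.2⟩, ?_⟩
      ext y
      simp only [Finset.mem_inter, Finset.mem_sdiff]
      tauto
  · intro D hD
    obtain ⟨E, hE, rfl⟩ := Finset.mem_image.1 hD
    have := Finset.card_sdiff_add_card_eq_card (mem_between.1 hE).2.1
    have := hav E hE
    omega

theorem exists_isSplit (h : IsSetLattice τ X) {x : α} (hx : x ∈ X) :
    ∃ M L, IsSplit τ M L ∧ x ∈ M ∧ x ∉ L := by
  obtain ⟨M, hM, hMmin⟩ := Finset.exists_min_image (τ.filter fun D => x ∈ D) Finset.card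
    ⟨X, by simp [h.top_mem, hx]⟩
  obtain ⟨L, hL, hLmax⟩ := Finset.exists_max_image (τ.filter fun D => x ∉ D) Finset.card
    ⟨∅, by simp [h.empty_mem]⟩
  simp only [Finset.mem_filter] at hM hL hMmin hLmax
  refine ⟨M, L, ⟨hM.1, hL.1, fun hML => hL.2 (hML hM.2), fun D hD => ?_⟩, hM.2, hL.2⟩
  by_cases hxD : x ∈ D
  · left
    have := hMmin (M ∩ D) ⟨h.inter _ hM.1 _ hD, by simp [hM.2, hxD]⟩
    exact Finset.inter_eq_left.1 (Finset.eq_of_subset_of_card_le Finset.inter_subset_left this)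
  · right
    have := hLmax (L ∪ D) ⟨h.union _ hL.1 _ hD, by simp [hL.2, hxD]⟩
    exact Finset.union_eq_left.1
      (Finset.eq_of_subset_of_card_le Finset.subset_union_left this).symm

theorem IsSplit.card_between_le_add (hs : IsSplit τ M L) (U V : Finset α) :
    (between τ U V).card ≤ (between τ U (L ∩ V)).card + (between τ (M ∪ U) V).card := by
  refine le_trans (Finset.card_le_card ?_) (Finset.card_union_le _ _)
  intro D hD
  obtain ⟨hD, hUD, hDV⟩ := mem_between.1 hD
  simp only [Finset.mem_union, mem_between]
  rcases hs.cases D hD with h | h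
  · exact Or.inr ⟨hD, Finset.union_subset h hUD, hDV⟩
  · exact Or.inl ⟨hD, hUD, Finset.subset_inter h hDV⟩

theorem IsSplit.card_le_add (hs : IsSplit τ M L) (h : IsSetLattice τ X) :
    τ.card ≤ (between τ ∅ L).card + (between τ M X).card := by
  have := hs.card_between_le_add ∅ X
  rwa [h.between_self, Finset.union_empty,
    Finset.inter_eq_left.2 (h.subset _ hs.right_mem)] at this

theorem IsSplit.card_sdiff_pos (hs : IsSplit τ M L) : 0 < (M \ L).card := by
  rw [Finset.card_pos]
  exact Finset.sdiff_nonempty.2 hs.not_subset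

/-- If the points of `V \ U` are pairwise distinguished by `τ`, then every size between those of
`U` and `V` is attained. -/
theorem exists_card_eq (h : IsSetLattice τ X) (hU : U ∈ τ) (hV : V ∈ τ) (hUV : U ⊆ V)
    (htriv : ∀ y ∈ V, y ∉ U → ∀ M L, IsSplit τ M L → y ∈ M → y ∉ L → (M \ L).card ≤ 1)
    {k : ℕ} (hk : U.card ≤ k) (hk' : k ≤ V.card) :
    ∃ W ∈ τ, U ⊆ W ∧ W ⊆ V ∧ W.card = k := by
  induction k, hk using Nat.le_induction with
  | base => exact ⟨U, hU, subset_rfl, hUV, rfl⟩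
  | succ k hk ih =>
    obtain ⟨W, hW, hUW, hWV, hWk⟩ := ih (by omega)
    have hVW : ¬ V ⊆ W := fun hVW => by
      have := Finset.card_le_card hVW
      omega
    obtain ⟨D, hD, hDmin⟩ := Finset.exists_min_image (τ.filter fun D => D ⊆ V ∧ ¬ D ⊆ W)
      Finset.card ⟨V, by simp [hV, hVW]⟩
    simp only [Finset.mem_filter] at hD hDmin
    obtain ⟨hD, hDV, hDW⟩ := hD
    obtain ⟨y, hyD, hyW⟩ := Finset.not_subset.1 hDW
    obtain ⟨M, L, hs, hyM, hyL⟩ := exists_isSplit h (h.subset _ hD hyD)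
    have hle := htriv y (hDV hyD) (fun hyU => hyW (hUW hyU)) M L hs hyM hyL
    have hMD : M ⊆ D := (hs.cases D hD).resolve_right fun hDL => hyL (hDL hyD)
    have hMeq : M = D := Finset.eq_of_subset_of_card_le hMD
      (hDmin M ⟨hs.left_mem, hMD.trans hDV, fun hMW => hyW (hMW hyM)⟩)
    have hsub : D \ W ⊆ M \ L := by
      intro z hz
      rw [Finset.mem_sdiff] at hz ⊢
      refine ⟨hMeq ▸ hz.1, fun hzL => ?_⟩
      have h1 := hDmin (D ∩ L) ⟨h.inter _ hD _ hs.right_mem,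
        Finset.inter_subset_left.trans hDV,
        fun hDLW => hz.2 (hDLW (Finset.mem_inter.2 ⟨hz.1, hzL⟩))⟩
      have h2 := Finset.eq_of_subset_of_card_le Finset.inter_subset_left h1
      exact hyL (Finset.inter_eq_left.1 h2 hyD)
    have h1 := Finset.card_le_card hsub
    have h2 : 0 < (D \ W).card := Finset.card_pos.2 (Finset.sdiff_nonempty.2 hDW)
    have h3 := Finset.card_sdiff_add_card D W
    refine ⟨D ∪ W, h.union _ hD _ hW, hUW.trans Finset.subset_union_right,
      Finset.union_subset hDV hWV, by omega⟩

/-- Unless an interval of `τ` is Boolean, it has at most three quarters of the members of a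
Boolean interval. -/
theorem mem_or_four_mul_card_between_le (h : IsSetLattice τ X) (hU : U ∈ τ) (hV : V ∈ τ)
    (hUV : U ⊆ V) :
    (∀ D, U ⊆ D → D ⊆ V → D ∈ τ) ∨ 4 * (between τ U V).card ≤ 3 * 2 ^ (V \ U).card := by
  by_cases hall : ∀ y ∈ V \ U, insert y U ∈ τ
  · left
    have key : ∀ S : Finset α, S ⊆ V \ U → U ∪ S ∈ τ := by
      intro S
      induction S using Finset.induction_on with
      | empty => intro _; simpa using hU
      | insert y S hyS ih =>
        intro hS
        have h1 := hall y (hS (Finset.mem_insert_self y S))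
        have h2 := ih ((Finset.subset_insert y S).trans hS)
        have h3 := h.union _ h1 _ h2
        convert h3 using 1
        ext z
        simp only [Finset.mem_union, Finset.mem_insert]
        tauto
    intro D hUD hDV
    have := key (D \ U) (Finset.sdiff_subset_sdiff hDV subset_rfl)
    rwa [Finset.union_sdiff_of_subset hUD] at this
  · right
    push Not at hall
    obtain ⟨y, hy, hyτ⟩ := hall
    have hy' := Finset.mem_sdiff.1 hy
    obtain ⟨M, L, hs, hyM, hyL⟩ := exists_isSplit h (h.subset _ hV hy'.1)
    have hMV : M ⊆ V := (hs.cases V hV).resolve_right fun hVL => hyL (hVL hy'.1)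
    have h1 := hs.card_between_le_add U V
    have h2 := card_between_le (τ := τ) (U := U) (V := L ∩ V)
    have h3 := card_between_le (τ := τ) (U := M ∪ U) (V := V)
    have h4 : ((L ∩ V) \ U).card + 1 ≤ (V \ U).card := by
      refine Finset.card_lt_card (Finset.ssubset_iff_subset_ne.2 ⟨?_, ?_⟩)
      · exact Finset.sdiff_subset_sdiff Finset.inter_subset_right subset_rfl
      · intro he
        rw [← he] at hy
        simp [hyL] at hy
    have h5 : (V \ (M ∪ U)).card + 2 ≤ (V \ U).card := by
      have e1 := Finset.card_sdiff_add_card_eq_card hUV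
      have e2 := Finset.card_sdiff_add_card_eq_card (Finset.union_subset hMV hUV)
      have e3 : (insert y U).card < (M ∪ U).card := by
        refine Finset.card_lt_card (Finset.ssubset_iff_subset_ne.2 ⟨?_, ?_⟩)
        · intro z hz
          rcases Finset.mem_insert.1 hz with rfl | hz
          · exact Finset.mem_union_left _ hyM
          · exact Finset.mem_union_right _ hz
        · intro he
          exact hyτ (he ▸ h.union _ hs.left_mem _ hU)
      rw [Finset.card_insert_of_notMem hy'.2] at e3
      omega
    have h6 := Nat.pow_le_pow_right (n := 2) (by norm_num) h4
    have h7 := Nat.pow_le_pow_right (n := 2) (by norm_num) h5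
    rw [pow_add] at h6 h7
    omega

theorem Avoids.between (hav : Avoids τ a b) (U V : Finset α) : Avoids (between τ U V) a b :=
  fun D hD => hav D (mem_between.1 hD).1

theorem IsSplit.card_add_le (hs : IsSplit τ M L) (h : IsSetLattice τ X) :
    L.card + (M \ L).card ≤ X.card := by
  have h1 := Finset.card_sdiff_add_card M L
  have h2 := Finset.card_le_card
    (Finset.union_subset (h.subset _ hs.left_mem) (h.subset _ hs.right_mem))
  omega

theorem IsSplit.card_le_of_lt_card_left (hB : BoundBelow α X.card) (h : IsSetLattice τ X)
    (ha : 1 ≤ a) (hab : a ≤ b) (hav : Avoids τ a b) (hs : IsSplit τ M L)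
    (hc : 2 ≤ (M \ L).card) (hm : b < M.card) :
    τ.card ≤ 2 ^ (a - 1) + 2 ^ (X.card - b - 1) := by
  have h0 := hs.card_le_add h
  have hln := hs.card_add_le h
  have hMX := h.subset _ hs.left_mem
  have hmn := Finset.card_le_card hMX
  have hR := card_between_le (τ := τ) (U := M) (V := X)
  have hXM := Finset.card_sdiff_add_card_eq_card hMX
  rcases Nat.lt_or_ge L.card a with hla | hla
  · have hL := card_between_le (τ := τ) (U := ∅) (V := L)
    rw [Finset.sdiff_empty] at hL
    have e1 := Nat.pow_le_pow_right (n := 2) (by norm_num) (show L.card ≤ a - 1 by omega)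
    have e2 := Nat.pow_le_pow_right (n := 2) (by norm_num)
      (show (X \ M).card ≤ X.card - b - 1 by omega)
    omega
  have hlb : b < L.card := by
    have := hav L hs.right_mem
    omega
  have hL := hB.card_between_le h h.empty_mem hs.right_mem (Finset.empty_subset L)
    (by simp; omega) (by simp; omega) hab hlb (hav.between _ _)
  rw [Finset.card_empty, Nat.sub_zero] at hL
  have e1 := Nat.pow_le_pow_right (n := 2) (by norm_num)
    (show L.card - b - 1 + 2 ≤ X.card - b - 1 by omega)
  rw [pow_add] at e1
  rcases Nat.lt_or_ge (b + 1) M.card with hm' | hm'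
  · have e2 := Nat.pow_le_pow_right (n := 2) (by norm_num)
      (show (X \ M).card + 1 ≤ X.card - b - 1 by omega)
    rw [pow_add] at e2
    omega
  · rcases mem_or_four_mul_card_between_le h hs.left_mem h.top_mem hMX with hall | hq
    · exfalso
      have h1 := Finset.card_sdiff_add_card_inter M L
      have h2 := hav _ (h.inter _ hs.left_mem _ hs.right_mem)
      obtain ⟨S, hS1, hS2, hS3⟩ := Finset.exists_subsuperset_card_eq
        (Finset.inter_subset_right : M ∩ L ⊆ L) (show (M ∩ L).card ≤ a by omega) hla
      have h3 : M ∪ S ∈ τ := hall _ Finset.subset_union_left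
        (Finset.union_subset hMX (hS2.trans (h.subset _ hs.right_mem)))
      have h4 : (M ∪ S) ∩ L = S := by
        rw [Finset.union_inter_distrib_right, Finset.inter_eq_left.2 hS2,
          Finset.union_eq_right.2 hS1]
      have h5 := hav _ (h.inter _ h3 _ hs.right_mem)
      rw [h4] at h5
      omega
    · rw [show (X \ M).card = X.card - b - 1 by omega] at hq
      omega

theorem IsSplit.card_le_of_add_lt (hB : BoundBelow α X.card) (h : IsSetLattice τ X)
    (hab : a ≤ b) (hb : b < X.card) (hav : Avoids τ a b) (hs : IsSplit τ M L)
    (hc : 2 ≤ (M \ L).card) (hm : M.card < a) (hl : b < L.card)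
    (hlm : L.card + M.card < a + b ∨
      L.card + M.card = a + b ∧ (M \ L).card + a ≤ b + 1) :
    τ.card ≤ 2 ^ (a - 1) + 2 ^ (X.card - b - 1) := by
  have h0 := hs.card_le_add h
  have hln := hs.card_add_le h
  have hMX := h.subset _ hs.left_mem
  have hI := h.inter _ hs.left_mem _ hs.right_mem
  have hML := Finset.card_sdiff_add_card_inter M L
  have hR := hB.card_between_le h hs.left_mem h.top_mem hMX (by omega) hm hab hb
    (hav.between _ _)
  have hP := card_between_le_mul h hI (Finset.empty_subset _)
    (Finset.inter_subset_right : M ∩ L ⊆ L)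
  have hP' := card_between_le (τ := τ) (U := ∅) (V := M ∩ L)
  rw [Finset.sdiff_empty] at hP'
  have hshift : ∀ D ∈ between τ (M ∩ L) L, (M ∪ D).card = D.card + (M \ L).card := by
    intro D hD
    obtain ⟨hD, hMD, hDL⟩ := mem_between.1 hD
    have h1 := Finset.card_sdiff_add_card M D
    have h2 : M \ D = M \ L := by
      ext z
      have h3 := @hMD z
      have h4 := @hDL z
      simp only [Finset.mem_sdiff, Finset.mem_inter] at h3 ⊢
      tauto
    rw [h2] at h1
    omega
  have key : ∃ b', a - (M \ L).card ≤ b' ∧ b' < L.card ∧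
      Avoids (between τ (M ∩ L) L) (a - (M \ L).card) b' ∧
      (M ∩ L).card + L.card + 1 ≤ a + b' := by
    rcases hlm with hlm | ⟨hlm, hcg⟩
    · refine ⟨b - (M \ L).card, by omega, by omega, fun D hD => ?_, by omega⟩
      have h1 := hav _ (h.union _ hs.left_mem _ (mem_between.1 hD).1)
      rw [hshift D hD] at h1
      omega
    · refine ⟨b, by omega, hl, fun D hD => ?_, by omega⟩
      have h1 := hav _ (h.union _ hs.left_mem _ (mem_between.1 hD).1)
      have h2 := hav _ (mem_between.1 hD).1
      rw [hshift D hD] at h1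
      omega
  obtain ⟨b', hb1, hb2, hav', hb3⟩ := key
  have hQ := hB.card_between_le h hI hs.right_mem Finset.inter_subset_right (by omega)
    (by omega) hb1 hb2 hav'
  have hL := hP.trans (Nat.mul_le_mul hP' hQ)
  rw [mul_add, ← pow_add, ← pow_add] at hL
  have e1 := Nat.pow_le_pow_right (n := 2) (by norm_num)
    (show (M ∩ L).card + (a - (M \ L).card - 1 - (M ∩ L).card) + 2 ≤ a - 1 by omega)
  have e2 := Nat.pow_le_pow_right (n := 2) (by norm_num)
    (show (M ∩ L).card + (L.card - b' - 1) + 1 ≤ a - 1 by omega)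
  have e3 := Nat.pow_le_pow_right (n := 2) (by norm_num)
    (show a - 1 - M.card + 2 ≤ a - 1 by omega)
  rw [pow_add _ _ 2] at e1 e3
  rw [pow_add _ _ 1] at e2
  omega

theorem sdiff_injOn (X : Finset α) : Set.InjOn (fun D => X \ D) {D | D ⊆ X} := by
  intro D hD E hE hDE
  simp only at hDE
  rw [← Finset.sdiff_sdiff_eq_self hD, hDE, Finset.sdiff_sdiff_eq_self hE]

theorem IsSetLattice.card_image_sdiff (h : IsSetLattice τ X) :
    (τ.image fun D => X \ D).card = τ.card :=
  Finset.card_image_of_injOn fun D hD E hE => sdiff_injOn X (h.subset D hD) (h.subset E hE)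

theorem IsSetLattice.image_sdiff (h : IsSetLattice τ X) :
    IsSetLattice (τ.image fun D => X \ D) X where
  empty_mem := Finset.mem_image.2 ⟨X, h.top_mem, by simp⟩
  top_mem := Finset.mem_image.2 ⟨∅, h.empty_mem, by simp⟩
  subset := by
    intro D hD
    obtain ⟨D, -, rfl⟩ := Finset.mem_image.1 hD
    exact Finset.sdiff_subset
  union := by
    intro D hD E hE
    obtain ⟨D, hD', rfl⟩ := Finset.mem_image.1 hD
    obtain ⟨E, hE', rfl⟩ := Finset.mem_image.1 hE
    exact Finset.mem_image.2 ⟨D ∩ E, h.inter _ hD' _ hE', sdiff_inf⟩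
  inter := by
    intro D hD E hE
    obtain ⟨D, hD', rfl⟩ := Finset.mem_image.1 hD
    obtain ⟨E, hE', rfl⟩ := Finset.mem_image.1 hE
    exact Finset.mem_image.2 ⟨D ∪ E, h.union _ hD' _ hE', Finset.sdiff_union_distrib X D E⟩

theorem IsSetLattice.card_sdiff_add (h : IsSetLattice τ X) (hD : D ∈ τ) :
    (X \ D).card + D.card = X.card :=
  Finset.card_sdiff_add_card_eq_card (h.subset D hD)

theorem Avoids.image_sdiff (h : IsSetLattice τ X) (hb : b < X.card) (hav : Avoids τ a b) :
    Avoids (τ.image fun D => X \ D) (X.card - b) (X.card - a) := by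
  intro D hD
  obtain ⟨D, hD', rfl⟩ := Finset.mem_image.1 hD
  have h1 := hav D hD'
  have h2 := h.card_sdiff_add hD'
  omega

theorem IsSplit.image_sdiff (h : IsSetLattice τ X) (hs : IsSplit τ M L) :
    IsSplit (τ.image fun D => X \ D) (X \ L) (X \ M) where
  left_mem := Finset.mem_image_of_mem _ hs.right_mem
  right_mem := Finset.mem_image_of_mem _ hs.left_mem
  not_subset := fun hLM => hs.not_subset
    ((Finset.sdiff_subset_sdiff_iff_subset (h.subset _ hs.right_mem)
      (h.subset _ hs.left_mem)).1 hLM)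
  cases := by
    intro D hD
    obtain ⟨D, hD', rfl⟩ := Finset.mem_image.1 hD
    rcases hs.cases D hD' with h1 | h1
    · exact Or.inr (Finset.sdiff_subset_sdiff subset_rfl h1)
    · exact Or.inl (Finset.sdiff_subset_sdiff subset_rfl h1)

theorem IsSplit.sdiff_sdiff_sdiff (h : IsSetLattice τ X) (hs : IsSplit τ M L) :
    (X \ L) \ (X \ M) = M \ L := by
  ext z
  have : z ∈ M → z ∈ X := fun hz => h.subset _ hs.left_mem hz
  simp only [Finset.mem_sdiff]
  tauto

/-- In a counterexample of minimal size every class of indistinguishable points is constrained. -/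
theorem IsSplit.card_constraints (hB : BoundBelow α X.card) (h : IsSetLattice τ X)
    (ha : 1 ≤ a) (hab : a ≤ b) (hb : b < X.card) (hav : Avoids τ a b)
    (hlt : 2 ^ (a - 1) + 2 ^ (X.card - b - 1) < τ.card) (hs : IsSplit τ M L)
    (hc : 2 ≤ (M \ L).card) :
    M.card < a ∧ b < L.card ∧ L.card + M.card = a + b ∧ b + 2 ≤ (M \ L).card + a := by
  have hs' := hs.image_sdiff h
  have h' := h.image_sdiff
  have hav' := hav.image_sdiff h hb
  have hc' := hc
  rw [← hs.sdiff_sdiff_sdiff h] at hc'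
  have hM := h.card_sdiff_add hs.left_mem
  have hL := h.card_sdiff_add hs.right_mem
  have hlt' := hlt
  rw [← h.card_image_sdiff, add_comm, show a - 1 = X.card - (X.card - a) - 1 by omega,
    show X.card - b - 1 = (X.card - b) - 1 by omega] at hlt'
  have hm : M.card < a := by
    have h1 := hav _ hs.left_mem
    have h2 := fun hm => hs.card_le_of_lt_card_left hB h ha hab hav hc hm
    omega
  have hl : b < L.card := by
    have h1 := hav _ hs.right_mem
    have h2 := fun hm => hs'.card_le_of_lt_card_left hB h' (by omega) (by omega) hav' hc' hm
    omega
  have h1 := fun hlm => hs.card_le_of_add_lt hB h hab hb hav hc hm hl hlm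
  have h2 := fun hlm => hs'.card_le_of_add_lt hB h' (by omega) (by omega) hav' hc'
    (by omega) (by omega) (Or.inl hlm)
  refine ⟨hm, hl, ?_, ?_⟩ <;> omega

/-- If all classes of indistinguishable points are large, then the bound holds. -/
theorem IsSetLattice.card_le_of_forall_isSplit (h : IsSetLattice τ X) (ha : 1 ≤ a) (hab : a ≤ b)
    (hb : b < X.card) (hs : ∀ M L, IsSplit τ M L → b + 2 ≤ (M \ L).card + a) :
    τ.card ≤ 2 ^ (a - 1) + 2 ^ (X.card - b - 1) := by
  set cls : α → Finset α := fun x => X.filter fun y => ∀ D ∈ τ, x ∈ D ↔ y ∈ D with hcls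
  have hself : ∀ x ∈ X, x ∈ cls x := fun x hx => by simp [hcls, hx]
  have heq : ∀ x ∈ X, ∀ y ∈ cls x, cls y = cls x := by
    intro x _ y hy
    simp only [hcls, Finset.mem_filter] at hy ⊢
    ext z
    simp only [Finset.mem_filter]
    refine and_congr_right fun _ => forall₂_congr fun D hD => ?_
    rw [hy.2 D hD]
  have hpow : τ.card ≤ 2 ^ (X.image cls).card := by
    rw [← Finset.card_powerset]
    refine Finset.card_le_card_of_injOn (fun D => D.image cls) ?_ ?_
    · intro D hD
      exact Finset.mem_powerset.2 (Finset.image_subset_image (h.subset D hD))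
    · have key : ∀ D ∈ τ, ∀ E ∈ τ, D.image cls = E.image cls → D ⊆ E := by
        intro D hD E hE hDE x hx
        have h1 := hDE ▸ Finset.mem_image_of_mem cls hx
        obtain ⟨y, hy, hyx⟩ := Finset.mem_image.1 h1
        have h2 : x ∈ cls y := hyx ▸ hself x (h.subset D hD hx)
        simp only [hcls, Finset.mem_filter] at h2
        exact (h2.2 E hE).1 hy
      intro D hD E hE hDE
      exact (key D hD E hE hDE).antisymm (key E hE D hD hDE.symm)
  have hfib : (X.image cls).card * (b + 2 - a) ≤ X.card := by
    rw [mul_comm]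
    refine Finset.mul_card_image_le_card (s := X) (f := cls) _ fun c hc => ?_
    obtain ⟨x, hx, rfl⟩ := Finset.mem_image.1 hc
    obtain ⟨M, L, hML, hxM, hxL⟩ := exists_isSplit h hx
    have h1 := hs M L hML
    have h2 : M \ L ⊆ X.filter fun y => cls y = cls x := by
      intro y hy
      rw [Finset.mem_sdiff] at hy
      have hyX := h.subset _ hML.left_mem hy.1
      refine Finset.mem_filter.2 ⟨hyX, heq x hx y ?_⟩
      refine Finset.mem_filter.2 ⟨hyX, fun D hD => ?_⟩
      rcases hML.cases D hD with hD | hD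
      · exact iff_of_true (hD hxM) (hD hy.1)
      · exact iff_of_false (fun h => hxL (hD h)) (fun h => hy.2 (hD h))
    have h3 := Finset.card_le_card h2
    omega
  generalize (X.image cls).card = k at hpow hfib
  rcases Nat.lt_or_ge (a - 1) k with hA | hA
  · rcases Nat.lt_or_ge (X.card - b - 1) k with hB | hB
    · obtain ⟨k, rfl⟩ : ∃ k', k = k' + 1 := ⟨k - 1, by omega⟩
      obtain ⟨d, hd⟩ : ∃ d, b + 2 - a = d + 2 := ⟨b - a, by omega⟩
      rw [hd] at hfib
      have : 2 * k ≤ k * (d + 2) := by nlinarith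
      have e1 : a - 1 = k := by nlinarith [show a - 1 + (X.card - b - 1) + (d + 2) = X.card by omega]
      have e2 : X.card - b - 1 = k := by
        nlinarith [show a - 1 + (X.card - b - 1) + (d + 2) = X.card by omega]
      rw [e1, e2, ← two_mul, ← pow_succ']
      exact hpow
    · have := Nat.pow_le_pow_right (n := 2) (by norm_num) hB
      exact hpow.trans (this.trans (Nat.le_add_left _ _))
  · have := Nat.pow_le_pow_right (n := 2) (by norm_num) hA
    exact hpow.trans (this.trans (Nat.le_add_right _ _))

/-- A distinguished point whose smallest neighbourhood has the least possible size is open. -/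
theorem exists_isSplit_singleton (h : IsSetLattice τ X) (hn : X.card ≤ a + b)
    (hbig : ∀ M L, IsSplit τ M L → 2 ≤ (M \ L).card → L.card + M.card = a + b)
    (hex : ∃ M L, IsSplit τ M L ∧ (M \ L).card ≤ 1) :
    ∃ x L, IsSplit τ {x} L := by
  classical
  obtain ⟨M₀, L₀, hs₀, hc₀⟩ := hex
  obtain ⟨M, hM, hmin⟩ := Finset.exists_min_image
    (τ.filter fun M => ∃ L, IsSplit τ M L ∧ (M \ L).card ≤ 1) Finset.card
    ⟨M₀, Finset.mem_filter.2 ⟨hs₀.left_mem, L₀, hs₀, hc₀⟩⟩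
  obtain ⟨-, L, hs, hc⟩ := Finset.mem_filter.1 hM
  have hsmall : ∀ M' L', IsSplit τ M' L' → M'.card < M.card →
      L'.card + M'.card = a + b := by
    intro M' L' hs' hlt
    refine hbig M' L' hs' ?_
    by_contra hc'
    have := hmin M' (Finset.mem_filter.2 ⟨hs'.left_mem, L', hs', by omega⟩)
    omega
  obtain ⟨x, hx⟩ : (M \ L).Nonempty := Finset.sdiff_nonempty.2 hs.not_subset
  rw [Finset.mem_sdiff] at hx
  rcases Finset.eq_empty_or_nonempty (M ∩ L) with he | ⟨y, hy⟩
  · refine ⟨x, L, ?_⟩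
    have h1 := Finset.card_sdiff_add_card_inter M L
    rw [he, Finset.card_empty] at h1
    exact (Finset.eq_of_subset_of_card_le (Finset.singleton_subset_iff.2 hx.1)
      (by rw [Finset.card_singleton]; omega)) ▸ hs
  · exfalso
    have hI := h.inter _ hs.left_mem _ hs.right_mem
    obtain ⟨M₁, L₁, hs₁, hyM₁, hyL₁⟩ := exists_isSplit h (h.subset _ hI hy)
    have hM₁ : M₁ ⊆ M ∩ L := (hs₁.cases _ hI).resolve_right fun hle => hyL₁ (hle hy)
    have hL₁ : L₁ ⊆ L := (hs.cases _ hs₁.right_mem).resolve_left fun hle =>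
      hyL₁ (hle (Finset.mem_inter.1 hy).1)
    have hxM₁ : x ∉ M₁ := fun hxM => hx.2 (Finset.mem_inter.1 (hM₁ hxM)).2
    have hlt₁ : M₁.card < M.card := Finset.card_lt_card
      (Finset.ssubset_iff_subset_ne.2 ⟨hM₁.trans Finset.inter_subset_left,
        fun he => hxM₁ (he ▸ hx.1)⟩)
    have hsum₁ := hsmall M₁ L₁ hs₁ hlt₁
    have hne : (M₁ ∩ L₁).Nonempty := by
      rw [Finset.nonempty_iff_ne_empty]
      intro he
      have h1 : insert x (M₁ ∪ L₁) ⊆ X := by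
        refine Finset.insert_subset (h.subset _ hs.left_mem hx.1) (Finset.union_subset
          (h.subset _ hs₁.left_mem) (h.subset _ hs₁.right_mem))
      have h2 := Finset.card_le_card h1
      have hxL₁ : x ∉ M₁ ∪ L₁ := by
        simp only [Finset.mem_union, not_or]
        exact ⟨hxM₁, fun hxL => hx.2 (hL₁ hxL)⟩
      rw [Finset.card_insert_of_notMem hxL₁,
        Finset.card_union_of_disjoint (Finset.disjoint_iff_inter_eq_empty.2 he)] at h2
      omega
    obtain ⟨z, hz⟩ := hne
    have hI₁ := h.inter _ hs₁.left_mem _ hs₁.right_mem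
    obtain ⟨M₂, L₂, hs₂, hzM₂, hzL₂⟩ := exists_isSplit h (h.subset _ hI₁ hz)
    have hM₂ : M₂ ⊆ M₁ ∩ L₁ := (hs₂.cases _ hI₁).resolve_right fun hle => hzL₂ (hle hz)
    have hL₂ : L₂ ⊆ L₁ := (hs₁.cases _ hs₂.right_mem).resolve_left fun hle =>
      hzL₂ (hle (Finset.mem_inter.1 hz).1)
    have hlt₂ : M₂.card < M₁.card := Finset.card_lt_card
      (Finset.ssubset_iff_subset_ne.2 ⟨hM₂.trans Finset.inter_subset_left,
        fun he => hyL₁ (Finset.mem_inter.1 (hM₂ (he ▸ hyM₁))).2⟩)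
    have hsum₂ := hsmall M₂ L₂ hs₂ (by omega)
    have := Finset.card_le_card hL₂
    omega

/-- The members containing an open point `x` when a class of at least three indistinguishable
points is incomparable to `x`. -/
theorem IsSplit.card_between_singleton_le (hB : BoundBelow α X.card) (h : IsSetLattice τ X)
    (hab : a ≤ b) (hav : Avoids τ a b) {x : α} (hx : {x} ∈ τ) (ha : 1 < a)
    (hs : IsSplit τ M L) (hxM : x ∉ M) (hxL : x ∈ L) (hl : b < L.card)
    (hlm : L.card + M.card = a + b) (hc : 3 ≤ (M \ L).card) :
    4 * (between τ {x} X).card ≤ 2 * 2 ^ (a - 1) + 3 * 2 ^ (X.card - b - 1) := by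
  have hln := hs.card_add_le h
  have h0 := hs.card_between_le_add {x} X
  rw [Finset.inter_eq_left.2 (h.subset _ hs.right_mem)] at h0
  have hMx := h.union _ hs.left_mem _ hx
  have hML := h.union _ hs.left_mem _ hs.right_mem
  have hMxc : (M ∪ {x}).card = M.card + 1 := by
    rw [Finset.union_comm, ← Finset.insert_eq, Finset.card_insert_of_notMem hxM]
  have hMLc := Finset.card_sdiff_add_card M L
  have hMLX := h.card_sdiff_add hML
  have hcM := Finset.card_le_card (Finset.sdiff_subset : M \ L ⊆ M)
  have hxL' : {x} ⊆ L := Finset.singleton_subset_iff.2 hxL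
  have h1 := hB.card_between_le h hx hs.right_mem hxL' (by omega) (by simpa using ha) hab hl
    (hav.between _ _)
  rw [Finset.card_singleton] at h1
  have hsub : M ∪ {x} ⊆ M ∪ L := Finset.union_subset_union subset_rfl hxL'
  have h2 := card_between_le_mul h hML hsub (h.subset _ hML)
  have h3 := card_between_le (τ := τ) (U := M ∪ L) (V := X)
  have h4 := hB.card_between_le h hMx hML hsub (a := a + (M \ L).card) (b := b + (M \ L).card)
    (by omega) (by omega) (by omega) (by omega) (by
      intro D hD
      obtain ⟨hD, hMD, hDL⟩ := mem_between.1 hD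
      have e1 := hav _ (h.inter _ hD _ hs.right_mem)
      have e2 := Finset.card_sdiff_add_card_inter D L
      have e3 : D \ L = M \ L := by
        ext z
        have e4 := @hMD z
        have e5 := @hDL z
        simp only [Finset.mem_sdiff, Finset.mem_union] at e4 e5 ⊢
        tauto
      rw [e3] at e2
      omega)
  have h5 := h2.trans (Nat.mul_le_mul h4 h3)
  rw [add_mul, ← pow_add, ← pow_add] at h5
  have e1 := Nat.pow_le_pow_right (n := 2) (by norm_num)
    (show a - 1 - 1 + 1 ≤ a - 1 by omega)
  have e2 := Nat.pow_le_pow_right (n := 2) (by norm_num)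
    (show L.card - b - 1 + 3 ≤ X.card - b - 1 by omega)
  have e3 := Nat.pow_le_pow_right (n := 2) (by norm_num)
    (show a + (M \ L).card - 1 - (M ∪ {x}).card + (X \ (M ∪ L)).card + 1 ≤ X.card - b - 1 by
      omega)
  have e4 := Nat.pow_le_pow_right (n := 2) (by norm_num)
    (show (M ∪ L).card - (b + (M \ L).card) - 1 + (X \ (M ∪ L)).card + 3 ≤ X.card - b - 1 by
      omega)
  rw [pow_add _ _ 1] at e1 e3
  rw [pow_add _ _ 3] at e2 e4
  omega

/-- The members avoiding an open point `x` when a class of exactly two indistinguishable points is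
incomparable to `x`. -/
theorem IsSplit.card_between_empty_le {N : Finset α} (hB : BoundBelow α X.card)
    (h : IsSetLattice τ X) (hn : X.card ≤ a + b) (hab : a ≤ b) (hav : Avoids τ a b)
    (hbig : ∀ M L, IsSplit τ M L → 2 ≤ (M \ L).card → L.card + M.card = a + b) {x : α}
    (hx : IsSplit τ {x} L) (hL : b < L.card) (hLX : L.card + 2 ≤ X.card)
    (hs : IsSplit τ M N) (hML : M ⊆ L) (hxN : x ∈ N) (hm : M.card < a)
    (hc : (M \ N).card = 2) :
    (between τ ∅ L).card ≤ 2 ^ (a - 2) := by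
  have hxL : x ∉ L := fun hxL => hx.not_subset (Finset.singleton_subset_iff.2 hxL)
  have hinsert : ∀ D ∈ τ, D ⊆ L → ¬ (a ≤ D.card + 1 ∧ D.card + 1 ≤ b) := by
    intro D hD hDL
    have h1 := hav _ (h.union _ hx.left_mem _ hD)
    rwa [← Finset.insert_eq, Finset.card_insert_of_notMem fun hxD => hxL (hDL hxD)] at h1
  have hsum := hbig M N hs (by omega)
  have hI := h.inter _ hs.left_mem _ hs.right_mem
  have hZ := h.inter _ hx.right_mem _ hs.right_mem
  have hW := h.union _ hs.left_mem _ hZ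
  have hIZ : M ∩ N ⊆ L ∩ N := Finset.inter_subset_inter_right hML
  have hWL : M ∪ L ∩ N ⊆ L := Finset.union_subset hML Finset.inter_subset_left
  have hIc := Finset.card_sdiff_add_card_inter M N
  have hWc : (M ∪ L ∩ N).card = (L ∩ N).card + 2 := by
    have h1 := Finset.card_sdiff_add_card M (L ∩ N)
    rw [show M \ (L ∩ N) = M \ N by
      ext z
      have := @hML z
      simp only [Finset.mem_sdiff, Finset.mem_inter]
      tauto] at h1
    omega
  have hWl := Finset.card_le_card hWL
  have hma := hinsert M hs.left_mem hML
  have hup : ∀ D ∈ between τ (M ∩ N) (L ∩ N), ¬ (a - 3 ≤ D.card ∧ D.card ≤ b) := by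
    intro D hD
    obtain ⟨hD, hID, hDZ⟩ := mem_between.1 hD
    have h1 := Finset.card_sdiff_add_card M D
    rw [show M \ D = M \ N by
      ext z
      have e1 := @hID z
      have e2 := @hDZ z
      simp only [Finset.mem_sdiff, Finset.mem_inter] at e1 e2 ⊢
      tauto] at h1
    have hDL := hDZ.trans Finset.inter_subset_left
    have hMD := h.union _ hs.left_mem _ hD
    have e1 := hav D hD
    have e2 := hinsert D hD hDL
    have e3 := hav _ hMD
    have e4 := hinsert _ hMD (Finset.union_subset hML hDL)
    omega
  have hdown : ∀ D ∈ between τ M (M ∪ L ∩ N), ¬ (a - 1 ≤ D.card ∧ D.card ≤ b + 2) := by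
    intro D hD
    obtain ⟨hD, hMD, hDW⟩ := mem_between.1 hD
    have h1 := Finset.card_sdiff_add_card_inter D N
    rw [show D \ N = M \ N by
      ext z
      have e1 := @hMD z
      have e2 := @hDW z
      simp only [Finset.mem_sdiff, Finset.mem_inter, Finset.mem_union] at e1 e2 ⊢
      tauto] at h1
    have hDL := hDW.trans hWL
    have hDN := h.inter _ hD _ hs.right_mem
    have e1 := hav D hD
    have e2 := hinsert D hD hDL
    have e3 := hav _ hDN
    have e4 := hinsert _ hDN (Finset.inter_subset_left.trans hDL)
    omega
  have hZb : b < (L ∩ N).card := by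
    have h1 := hup (L ∩ N) (mem_between.2 ⟨hZ, hIZ, subset_rfl⟩)
    by_contra hZb
    obtain ⟨D, hD, -, -, hDa⟩ := exists_card_eq h hW hx.right_mem hWL (k := a) (by
      intro y hyL hyW M' N' hs' hyM' hyN'
      by_contra hc'
      have hyN : y ∉ N := fun hyN =>
        hyW (Finset.mem_union_right _ (Finset.mem_inter.2 ⟨hyL, hyN⟩))
      have hyM : y ∉ M := fun hyM => hyW (Finset.mem_union_left _ hyM)
      have h2 : N ⊆ N' := (hs'.cases _ hs.right_mem).resolve_left fun hle => hyN (hle hyM')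
      have h3 : M ⊆ M' := (hs.cases _ hs'.left_mem).resolve_right fun hle => hyN (hle hyM')
      have h4 := Finset.card_le_card h2
      have h5 := Finset.card_lt_card
        (Finset.ssubset_iff_subset_ne.2 ⟨h3, fun he => hyM (he ▸ hyM')⟩)
      have h6 := hbig M' N' hs' (by omega)
      omega) (by omega) (by omega)
    have := hav D hD
    omega
  have hZN : (L ∩ N).card < N.card := Finset.card_lt_card
    (Finset.ssubset_iff_subset_ne.2 ⟨Finset.inter_subset_right,
      fun he => hxL (Finset.inter_eq_right.1 he hxN)⟩)
  have hLN := Finset.card_union_add_card_inter L N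
  have hLNX := Finset.card_le_card
    (Finset.union_subset (h.subset _ hx.right_mem) (h.subset _ hs.right_mem))
  have h0 := hs.card_between_le_add ∅ L
  rw [Finset.union_empty, Finset.inter_comm] at h0
  have hA1 := card_between_le_mul h hI (Finset.empty_subset _) hIZ
  have hA2 := card_between_le (τ := τ) (U := ∅) (V := M ∩ N)
  rw [Finset.sdiff_empty] at hA2
  have hA3 := hB.card_between_le h hI hZ hIZ (a := a - 3) (b := b) (by omega) (by omega)
    (by omega) hZb hup
  have hB1 := card_between_le_mul h hW Finset.subset_union_left hWL
  have hB2 := hB.card_between_le h hs.left_mem hW Finset.subset_union_left (a := a - 1)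
    (b := b + 2) (by omega) (by omega) (by omega) (by omega) hdown
  have hB3 := card_between_le (τ := τ) (U := M ∪ L ∩ N) (V := L)
  have hLW := Finset.card_sdiff_add_card_eq_card hWL
  have hA := hA1.trans (Nat.mul_le_mul hA2 hA3)
  have hB' := hB1.trans (Nat.mul_le_mul hB2 hB3)
  rw [mul_add, ← pow_add, ← pow_add] at hA
  rw [add_mul, ← pow_add, ← pow_add] at hB'
  have e1 := Nat.pow_le_pow_right (n := 2) (by norm_num)
    (show (M ∩ N).card + (a - 3 - 1 - (M ∩ N).card) + 2 ≤ a - 2 by omega)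
  have e2 := Nat.pow_le_pow_right (n := 2) (by norm_num)
    (show (M ∩ N).card + ((L ∩ N).card - b - 1) + 2 ≤ a - 2 by omega)
  have e3 := Nat.pow_le_pow_right (n := 2) (by norm_num)
    (show a - 1 - 1 - M.card + (L \ (M ∪ L ∩ N)).card + 2 ≤ a - 2 by omega)
  have e4 := Nat.pow_le_pow_right (n := 2) (by norm_num)
    (show (M ∪ L ∩ N).card - (b + 2) - 1 + (L \ (M ∪ L ∩ N)).card + 2 ≤ a - 2 by omega)
  rw [pow_add _ _ 2] at e1 e2 e3 e4
  omega

/-- If some singleton is the left half of a split, then the bound holds. -/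
theorem IsSplit.card_le_of_singleton (hB : BoundBelow α X.card) (h : IsSetLattice τ X)
    (hn : X.card ≤ a + b) (ha : 1 ≤ a) (hab : a ≤ b) (hb : b < X.card) (hav : Avoids τ a b)
    (hbig : ∀ M L, IsSplit τ M L → 2 ≤ (M \ L).card →
      M.card < a ∧ b < L.card ∧ L.card + M.card = a + b) {x : α} (hs : IsSplit τ {x} L) :
    τ.card ≤ 2 ^ (a - 1) + 2 ^ (X.card - b - 1) := by
  have hxL : x ∉ L := fun hxL => hs.not_subset (Finset.singleton_subset_iff.2 hxL)
  have hxX := h.subset _ hs.left_mem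
  have h0 := hs.card_le_add h
  have hcx : ({x} : Finset α).card = 1 := Finset.card_singleton x
  have hLX := hs.card_add_le h
  have hpos := hs.card_sdiff_pos
  have ha' : 1 < a := by
    have := hav _ hs.left_mem
    omega
  have hinsert : ∀ D ∈ τ, D ⊆ L → ¬ (a ≤ D.card + 1 ∧ D.card + 1 ≤ b) := by
    intro D hD hDL
    have h1 := hav _ (h.union _ hs.left_mem _ hD)
    rwa [← Finset.insert_eq, Finset.card_insert_of_notMem fun hxD => hxL (hDL hxD)] at h1
  have hup := hB.card_between_le h hs.left_mem h.top_mem hxX (by omega) (by omega) hab hb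
    (hav.between _ _)
  rw [hcx] at hup
  have e1 := Nat.pow_le_pow_right (n := 2) (by norm_num) (show a - 1 - 1 + 1 ≤ a - 1 by omega)
  rw [pow_add _ _ 1] at e1
  have hL1 := hav _ hs.right_mem
  rcases Nat.lt_or_ge b L.card with hbL | hbL
  swap
  · have h1 := hinsert L hs.right_mem subset_rfl
    have h2 := card_between_le (τ := τ) (U := ∅) (V := L)
    rw [Finset.sdiff_empty] at h2
    have e2 := Nat.pow_le_pow_right (n := 2) (by norm_num) (show L.card ≤ a - 1 - 1 by omega)
    omega
  have hlow := hB.card_between_le h h.empty_mem hs.right_mem (Finset.empty_subset _)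
    (a := a - 1) (b := b) (by simp; omega) (by simp; omega) (by omega) hbL (by
      intro D hD
      obtain ⟨hD, -, hDL⟩ := mem_between.1 hD
      have e2 := hav D hD
      have e3 := hinsert D hD hDL
      omega)
  rw [Finset.card_empty, Nat.sub_zero] at hlow
  rcases Nat.lt_or_ge X.card (L.card + 2) with hl | hl
  · rcases Nat.lt_or_ge (b + 1) X.card with hbX | hbX
    swap
    · omega
    have hup' := hB.card_between_le h hs.left_mem h.top_mem hxX (a := a) (b := b + 1) (by omega)
      (by omega) (by omega) hbX (by
        intro D hD
        obtain ⟨hD, hxD, hDX⟩ := mem_between.1 hD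
        have e2 := hav D hD
        have e3 := hav _ (h.inter _ hD _ hs.right_mem)
        have e4 := Finset.card_sdiff_add_card_inter D L
        have e5 := Finset.card_le_card (Finset.sdiff_subset_sdiff hDX (subset_refl L))
        have e6 := Finset.card_sdiff_add_card_eq_card (h.subset _ hs.right_mem)
        have e7 := Finset.card_pos.2
          ⟨x, Finset.mem_sdiff.2 ⟨hxD (Finset.mem_singleton_self x), hxL⟩⟩
        omega)
    rw [hcx] at hup'
    have e2 := Nat.pow_le_pow_right (n := 2) (by norm_num)
      (show L.card - b - 1 + 1 ≤ X.card - b - 1 by omega)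
    have e3 := Nat.pow_le_pow_right (n := 2) (by norm_num)
      (show X.card - (b + 1) - 1 + 1 ≤ X.card - b - 1 by omega)
    rw [pow_add _ _ 1] at e2 e3
    omega
  obtain ⟨M, N, hMN, hML, hxM, hxN, hc⟩ : ∃ M N, IsSplit τ M N ∧ M ⊆ L ∧ x ∉ M ∧ x ∈ N ∧
      2 ≤ (M \ N).card := by
    by_contra! hcon
    obtain ⟨D, hD, -, -, hDa⟩ := exists_card_eq h h.empty_mem hs.right_mem
      (Finset.empty_subset L) (k := a) (by
        intro y hyL _ M N hMN hyM hyN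
        have hML : M ⊆ L := (hMN.cases _ hs.right_mem).resolve_right fun hle => hyN (hle hyL)
        have hxN : x ∈ N := by
          refine Finset.singleton_subset_iff.1 ((hMN.cases _ hs.left_mem).resolve_left
            fun hle => hxL ?_)
          rw [← Finset.mem_singleton.1 (hle hyM)]
          exact hyL
        have := hcon M N hMN hML (fun hxM => hxL (hML hxM)) hxN
        omega) (by simp) (by omega)
    have := hav D hD
    omega
  obtain ⟨hm, hN, hNM⟩ := hbig M N hMN hc
  rcases Nat.lt_or_ge 2 (M \ N).card with hc3 | hc3
  · have h1 := hMN.card_between_singleton_le hB h hab hav hs.left_mem ha' hxM hxN hN hNM hc3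
    have e2 := Nat.pow_le_pow_right (n := 2) (by norm_num)
      (show L.card - b - 1 + 2 ≤ X.card - b - 1 by omega)
    rw [pow_add _ _ 2] at e2
    omega
  · have h1 := IsSplit.card_between_empty_le hB h hn hab hav
      (fun M L hs hc => (hbig M L hs hc).2.2) hs hbL hl hMN hML hxN hm (by omega)
    rw [show a - 2 = a - 1 - 1 by omega] at h1
    omega

theorem boundBelow (n : ℕ) : BoundBelow α n := by
  induction n with
  | zero => exact fun X _ _ _ hX => absurd hX (Nat.not_lt_zero _)
  | succ n ih =>
    intro X τ a b hX h ha hab hb hav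
    rcases Nat.lt_or_ge X.card n with hlt | hge
    · exact ih X τ a b hlt h ha hab hb hav
    obtain rfl : n = X.card := by omega
    have key : ∀ (σ : Finset (Finset α)) (p q : ℕ), X.card ≤ p + q → IsSetLattice σ X →
        1 ≤ p → p ≤ q → q < X.card → Avoids σ p q →
        σ.card ≤ 2 ^ (p - 1) + 2 ^ (X.card - q - 1) := by
      intro σ p q hn hσ hp hpq hq hσa
      by_contra! hlt
      have hcon := fun M L (hs : IsSplit σ M L) hc =>
        hs.card_constraints ih hσ hp hpq hq hσa hlt hc
      by_cases hex : ∃ M L, IsSplit σ M L ∧ (M \ L).card ≤ 1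
      · obtain ⟨x, L, hs⟩ := exists_isSplit_singleton hσ hn
          (fun M L hs hc => (hcon M L hs hc).2.2.1) hex
        have := hs.card_le_of_singleton ih hσ hn hp hpq hq hσa
          (fun M L hs hc => ⟨(hcon M L hs hc).1, (hcon M L hs hc).2.1, (hcon M L hs hc).2.2.1⟩)
        omega
      · push Not at hex
        have := hσ.card_le_of_forall_isSplit hp hpq hq
          fun M L hs => (hcon M L hs (hex M L hs)).2.2.2
        omega
    rcases Nat.le_total X.card (a + b) with hn | hn
    · exact key τ a b hn h ha hab hb hav
    · have := key _ (X.card - b) (X.card - a) (by omega) h.image_sdiff (by omega) (by omega)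
        (by omega) (hav.image_sdiff h hb)
      rwa [h.card_image_sdiff, add_comm, show X.card - (X.card - a) - 1 = a - 1 by omega] at this

end SetLattice

/-- A topology on an `n`-set with no open set of cardinality `j` (`1 ≤ j ≤ n-1`) has at
most `2^{j-1} + 2^{n-j-1}` open sets. -/
theorem card_le_of_no_open_of_card {n j : ℕ} (τ : Finset (Finset (Fin n)))
    (hτ : IsTopology τ) (hj1 : 1 ≤ j) (hj2 : j ≤ n - 1)
    (h : ∀ s ∈ τ, s.card ≠ j) :
    τ.card ≤ 2 ^ (j - 1) + 2 ^ (n - j - 1) := by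
  have hlat : IsSetLattice τ Finset.univ :=
    ⟨hτ.1, hτ.2.1, fun D _ => Finset.subset_univ D, hτ.2.2.1, hτ.2.2.2⟩
  have := boundBelow (n + 1) Finset.univ τ j j (by simp) hlat hj1 le_rfl (by simp; omega)
    fun D hD hDj => h D hD (by omega)
  simpa using this
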